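/- arXiv:1605.08739 — 7 statements merged into one kernel-verified Lean document; each statement's English description precedes it below -/
import Mathlib

section
/- The proportion of coprime pairs in a square tends to 1/ζ(2): for each positive integer h let C_h be the number of pairs of integers (x,y) with 1 ≤ x ≤ h, 1 ≤ y ≤ h and gcd(x,y) = 1. Then C_h / h² tends to 6/π² as h → ∞. -/
open Filter Topology

/-- `C h` is the number of pairs `(x, y)` with `1 ≤ x ≤ h`, `1 ≤ y ≤ h` and `gcd x y = 1`. -/
def coprimePairCount (h : ℕ) : ℕ :=
  ((Finset.Icc 1 h ×ˢ Finset.Icc 1 h).filter (fun p => Nat.gcd p.1 p.2 = 1)).card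

open ArithmeticFunction in
theorem sum_divisors_moebius {n : ℕ} :
    ∑ d ∈ n.divisors, moebius d = if n = 1 then 1 else 0 := by
  rw [← coe_mul_zeta_apply, moebius_mul_coe_zeta, one_apply]

open ArithmeticFunction in
/-- The Dirichlet series of the Möbius function at `2`. -/
theorem tsum_moebius_div_sq :
    ∑' d : ℕ, (moebius d : ℝ) / (d : ℝ) ^ 2 = 6 / Real.pi ^ 2 := by
  have hs : (1 : ℝ) < (2 : ℂ).re := by norm_num
  have key := LSeries_zeta_mul_Lseries_moebius hs
  rw [LSeries_zeta_eq_riemannZeta hs, riemannZeta_two] at key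
  have hL : LSeries (fun n => ((moebius n : ℤ) : ℂ)) 2
      = ((∑' d : ℕ, (moebius d : ℝ) / (d : ℝ) ^ 2 : ℝ) : ℂ) := by
    rw [LSeries, Complex.ofReal_tsum]
    refine tsum_congr fun d => ?_
    rcases eq_or_ne d 0 with rfl | hd
    · simp
    · rw [LSeries.term_of_ne_zero hd]
      push_cast
      norm_cast
  rw [hL] at key
  have key' : Real.pi ^ 2 / 6 * ∑' d : ℕ, (moebius d : ℝ) / (d : ℝ) ^ 2 = 1 := by
    exact_mod_cast key
  have hpi := Real.pi_ne_zero
  rw [eq_div_iff (pow_ne_zero 2 hpi)]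
  linarith

open ArithmeticFunction in
theorem coprimePairCount_eq_sum (h : ℕ) :
    (coprimePairCount h : ℤ) = ∑ d ∈ Finset.Icc 1 h, moebius d * ((h / d : ℕ) : ℤ) ^ 2 := by
  have hcard (d : ℕ) : ((Finset.Icc 1 h).filter (d ∣ ·)).card = h / d :=
    Nat.Ioc_filter_dvd_card_eq_div h d
  have hgcd : ∀ p ∈ Finset.Icc 1 h ×ˢ Finset.Icc 1 h,
      (if Nat.gcd p.1 p.2 = 1 then (1 : ℤ) else 0)
        = ∑ d ∈ Finset.Icc 1 h, if d ∣ p.1 ∧ d ∣ p.2 then moebius d else 0 := by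
    rintro ⟨x, y⟩ hp
    simp only [Finset.mem_product, Finset.mem_Icc] at hp
    rw [← sum_divisors_moebius, ← Finset.sum_filter]
    refine Finset.sum_congr ?_ fun _ _ => rfl
    ext d
    simp only [Nat.mem_divisors, Finset.mem_filter, Finset.mem_Icc, Nat.dvd_gcd_iff]
    constructor
    · rintro ⟨⟨hx, hy⟩, -⟩
      exact ⟨⟨Nat.pos_of_dvd_of_pos hx (by omega),
        (Nat.le_of_dvd (by omega) hx).trans (by omega)⟩, hx, hy⟩
    · rintro ⟨-, hx, hy⟩
      exact ⟨⟨hx, hy⟩, (Nat.gcd_pos_of_pos_left _ (by omega)).ne'⟩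
  rw [coprimePairCount, Finset.card_filter, Nat.cast_sum]
  simp only [Nat.cast_ite, Nat.cast_one, Nat.cast_zero]
  rw [Finset.sum_congr rfl hgcd, Finset.sum_comm]
  refine Finset.sum_congr rfl fun d _ => ?_
  rw [← Finset.sum_filter, Finset.sum_const, Finset.filter_product (d ∣ ·) (d ∣ ·),
    Finset.card_product, hcard, nsmul_eq_mul]
  push_cast
  ring

open ArithmeticFunction in
theorem coprimePairCount_div_sq_eq_tsum (h : ℕ) :
    (coprimePairCount h : ℝ) / (h : ℝ) ^ 2
      = ∑' d : ℕ, (moebius d : ℝ) * (((h / d : ℕ) : ℝ) / h) ^ 2 := by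
  rw [tsum_eq_sum (s := Finset.Icc 1 h)]
  · have hC : (coprimePairCount h : ℝ)
        = ∑ d ∈ Finset.Icc 1 h, (moebius d : ℝ) * ((h / d : ℕ) : ℝ) ^ 2 := by
      have := congrArg (Int.cast : ℤ → ℝ) (coprimePairCount_eq_sum h)
      simpa only [Int.cast_sum, Int.cast_mul, Int.cast_pow, Int.cast_natCast] using this
    rw [hC, Finset.sum_div]
    refine Finset.sum_congr rfl fun d _ => ?_
    rw [div_pow, mul_div_assoc]
  · intro d hd
    rcases Nat.eq_zero_or_pos d with rfl | hd0
    · simp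
    · have hlt : h < d := by
        simp only [Finset.mem_Icc] at hd
        omega
      simp [Nat.div_eq_of_lt hlt]

theorem tendsto_natDiv_div_atTop (d : ℕ) :
    Tendsto (fun h : ℕ => ((h / d : ℕ) : ℝ) / h) atTop (𝓝 (1 / d)) := by
  have := (tendsto_nat_floor_mul_div_atTop (R := ℝ) (a := 1 / d) (by positivity)).comp
    tendsto_natCast_atTop_atTop
  refine this.congr fun h => ?_
  simp only [Function.comp_apply]
  rw [one_div_mul_eq_div, Nat.floor_div_eq_div]

theorem coprime_density :
    Tendsto (fun h : ℕ => (coprimePairCount h : ℝ) / (h : ℝ) ^ 2) atTop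
      (nhds (6 / Real.pi ^ 2)) := by
  simp only [coprimePairCount_div_sq_eq_tsum]
  rw [← tsum_moebius_div_sq]
  refine tendsto_tsum_of_dominated_convergence
    (bound := fun d : ℕ => 1 / (d : ℝ) ^ 2) hasSum_zeta_two.summable (fun d => ?_)
    (Eventually.of_forall fun h d => ?_)
  · have := ((tendsto_natDiv_div_atTop d).pow 2).const_mul (ArithmeticFunction.moebius d : ℝ)
    simpa [div_eq_mul_inv] using this
  · have hμ : |(ArithmeticFunction.moebius d : ℝ)| ≤ 1 := by
      exact_mod_cast ArithmeticFunction.abs_moebius_le_one (n := d)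
    have hle : ((h / d : ℕ) : ℝ) / h ≤ 1 / d := by
      rcases Nat.eq_zero_or_pos h with rfl | hh
      · simp
      · rw [div_le_iff₀ (by positivity), one_div_mul_eq_div]
        exact Nat.cast_div_le
    rw [Real.norm_eq_abs, abs_mul, abs_of_nonneg (sq_nonneg (((h / d : ℕ) : ℝ) / h))]
    calc |(ArithmeticFunction.moebius d : ℝ)| * (((h / d : ℕ) : ℝ) / h) ^ 2
        ≤ 1 * (1 / (d : ℝ)) ^ 2 := by gcongr
      _ = 1 / (d : ℝ) ^ 2 := by rw [one_mul, div_pow, one_pow]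
end

section
/- If u, v ∈ ℤ² are linearly independent over ℝ and the closed triangle with vertices 0, u, v contains no lattice point other than 0, u, and v, then |det(u,v)| = 1, where det(u,v) = u₁v₂ − u₂v₁. -/
/-- The determinant of the `2 × 2` matrix with columns `u` and `v`. -/
def det2 (u v : ℤ × ℤ) : ℤ := u.1 * v.2 - u.2 * v.1

/-- The image of a lattice vector in `ℝ²`. -/
def toR (u : ℤ × ℤ) : ℝ × ℝ := ((u.1 : ℝ), (u.2 : ℝ))

theorem toR_mem_convexHull_triangle {u v w : ℤ × ℤ} (hd : 0 < det2 u v)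
    (ha : 0 ≤ det2 w v) (hb : 0 ≤ det2 u w) (hab : det2 w v + det2 u w ≤ det2 u v) :
    toR w ∈ convexHull ℝ {(0 : ℝ × ℝ), toR u, toR v} := by
  have hd' : (0 : ℝ) < det2 u v := by exact_mod_cast hd
  have ha' : (0 : ℝ) ≤ det2 w v := by exact_mod_cast ha
  have hb' : (0 : ℝ) ≤ det2 u w := by exact_mod_cast hb
  have hab' : (det2 w v : ℝ) + det2 u w ≤ det2 u v := by exact_mod_cast hab
  have hw : toR w = ∑ i : Fin 3, (![1 - (det2 w v : ℝ) / det2 u v - (det2 u w : ℝ) / det2 u v,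
      (det2 w v : ℝ) / det2 u v, (det2 u w : ℝ) / det2 u v] i) •
        (![(0 : ℝ × ℝ), toR u, toR v] i) := by
    ext <;> simp [Fin.sum_univ_three, toR] <;> field_simp <;> simp only [det2] <;>
      push_cast <;> ring
  rw [hw]
  refine (convex_convexHull ℝ _).sum_mem ?_ ?_ ?_
  · have h : (det2 w v : ℝ) / det2 u v + (det2 u w : ℝ) / det2 u v ≤ 1 := by
      rw [← add_div]
      exact (div_le_one hd').2 hab'
    intro i _
    fin_cases i
    · simp
      linarith
    · exact div_nonneg ha' hd'.le
    · exact div_nonneg hb' hd'.le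
  · simp only [Fin.sum_univ_three, Matrix.cons_val]
    ring
  · intro i _
    apply subset_convexHull
    fin_cases i <;> simp

/-- If the triangle `0`, `u`, `v` is empty, the Cramer coordinates of every lattice vector in the
basis `u`, `v` are integers. -/
theorem det2_dvd_of_empty_triangle {u v : ℤ × ℤ} (hd : 0 < det2 u v)
    (htri : ∀ w : ℤ × ℤ, toR w ∈ convexHull ℝ {(0 : ℝ × ℝ), toR u, toR v} →
      w = 0 ∨ w = u ∨ w = v) (w : ℤ × ℤ) :
    det2 u v ∣ det2 w v ∧ det2 u v ∣ det2 u w := by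
  have ha₀ := Int.emod_nonneg (det2 w v) hd.ne'
  have hb₀ := Int.emod_nonneg (det2 u w) hd.ne'
  have ha₁ := Int.emod_lt_of_pos (det2 w v) hd
  have hb₁ := Int.emod_lt_of_pos (det2 u w) hd
  have ha := Int.emod_add_mul_ediv (det2 w v) (det2 u v)
  have hb := Int.emod_add_mul_ediv (det2 u w) (det2 u v)
  rw [Int.dvd_iff_emod_eq_zero, Int.dvd_iff_emod_eq_zero]
  generalize det2 w v % det2 u v = a at *
  generalize det2 u w % det2 u v = b at *
  generalize det2 w v / det2 u v = m at *
  generalize det2 u w / det2 u v = n at *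
  have key : ∀ x : ℤ × ℤ, 0 ≤ det2 x v → 0 ≤ det2 u x → det2 x v + det2 u x ≤ det2 u v →
      det2 x v < det2 u v → det2 u x < det2 u v → det2 x v = 0 ∧ det2 u x = 0 := by
    intro x h₁ h₂ h₃ h₄ h₅
    rcases htri x (toR_mem_convexHull_triangle hd h₁ h₂ h₃) with rfl | rfl | rfl
    · simp [det2]
    · exact absurd h₄ (lt_irrefl _)
    · exact absurd h₅ (lt_irrefl _)
  rcases le_or_gt (a + b) (det2 u v) with h | h
  · have e₁ : det2 (w - m • u - n • v) v = a := by
      simp [det2] at ha ⊢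
      linarith
    have e₂ : det2 u (w - m • u - n • v) = b := by
      simp [det2] at hb ⊢
      linarith
    have := key (w - m • u - n • v)
    rw [e₁, e₂] at this
    exact this ha₀ hb₀ h ha₁ hb₁
  · have e₁ : det2 (u + v - (w - m • u - n • v)) v = det2 u v - a := by
      simp [det2] at ha ⊢
      linarith
    have e₂ : det2 u (u + v - (w - m • u - n • v)) = det2 u v - b := by
      simp [det2] at hb ⊢
      linarith
    have := key (u + v - (w - m • u - n • v))
    rw [e₁, e₂] at this
    have := this (by linarith) (by linarith) (by linarith) (by linarith) (by linarith)
    omega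

theorem det2_eq_one_of_empty_triangle {u v : ℤ × ℤ} (hd : 0 < det2 u v)
    (htri : ∀ w : ℤ × ℤ, toR w ∈ convexHull ℝ {(0 : ℝ × ℝ), toR u, toR v} →
      w = 0 ∨ w = u ∨ w = v) : det2 u v = 1 := by
  obtain ⟨h₁, h₂⟩ := det2_dvd_of_empty_triangle hd htri (1, 0)
  obtain ⟨h₃, h₄⟩ := det2_dvd_of_empty_triangle hd htri (0, 1)
  have hsq : det2 u v * det2 u v ∣ det2 u v * 1 := by
    have e : det2 u v * 1 = det2 u (0, 1) * det2 (1, 0) v - det2 u (1, 0) * det2 (0, 1) v := by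
      simp [det2]
    rw [e]
    exact dvd_sub (mul_dvd_mul h₄ h₁) (mul_dvd_mul h₂ h₃)
  exact Int.eq_one_of_dvd_one hd.le (Int.dvd_of_mul_dvd_mul_left hd.ne' hsq)

theorem det2_ne_zero_of_linearIndependent {u v : ℤ × ℤ}
    (hindep : ∀ a b : ℝ, a • toR u + b • toR v = 0 → a = 0 ∧ b = 0) : det2 u v ≠ 0 := by
  intro h
  have hR : (u.1 : ℝ) * v.2 - u.2 * v.1 = 0 := by exact_mod_cast h
  have h₁ := hindep v.1 (-u.1) (by ext <;> simp [toR] <;> linarith)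
  have h₂ := hindep v.2 (-u.2) (by ext <;> simp [toR] <;> linarith)
  have h₃ := hindep 1 0 (by ext <;> simp_all [toR])
  exact one_ne_zero h₃.1

/-- If `u, v ∈ ℤ²` are linearly independent over `ℝ` and the closed triangle with
vertices `0`, `u`, `v` contains no lattice points besides `0`, `u`, `v`, then
`|det(u,v)| = 1`. -/
theorem empty_triangle_unimodular (u v : ℤ × ℤ)
    (hindep : ∀ a b : ℝ, a • toR u + b • toR v = 0 → a = 0 ∧ b = 0)
    (htri : ∀ w : ℤ × ℤ, toR w ∈ convexHull ℝ {(0 : ℝ × ℝ), toR u, toR v} →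
      w = 0 ∨ w = u ∨ w = v) :
    |det2 u v| = 1 := by
  have hswap : det2 v u = -det2 u v := by
    simp only [det2]
    ring
  rcases (det2_ne_zero_of_linearIndependent hindep).lt_or_gt with h | h
  · rw [abs_of_neg h, ← hswap]
    refine det2_eq_one_of_empty_triangle (by linarith) fun w hw => ?_
    rw [Set.pair_comm] at hw
    exact (htri w hw).imp_right Or.symm
  · rw [abs_of_pos h]
    exact det2_eq_one_of_empty_triangle h htri
end

section
/- Lemma (the complete fan Σ_h is smooth): Fix h ≥ 1. If u, v ∈ ℤ² are primitive vectors with ‖u‖ ≤ h and ‖v‖ ≤ h, det(u,v) > 0, and no primitive vector w with ‖w‖ ≤ h lies in the open cone {a·u + b·v : a, b ∈ ℝ, a > 0, b > 0}, then det(u,v) = 1. -/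
/-- A vector `u ∈ ℤ²` is primitive if it is nonzero and its coordinates are coprime. -/
def Primitive (u : ℤ × ℤ) : Prop := u ≠ 0 ∧ Int.gcd u.1 u.2 = 1

/-- The sup norm of a lattice vector, as a natural number. -/
def hgt (u : ℤ × ℤ) : ℕ := max u.1.natAbs u.2.natAbs

/-- `w` lies in the open cone `{a·u + b·v : a, b ∈ ℝ, a > 0, b > 0}`. -/
def InOpenCone (u v w : ℤ × ℤ) : Prop :=
  ∃ a b : ℝ, 0 < a ∧ 0 < b ∧
    (w.1 : ℝ) = a * u.1 + b * v.1 ∧ (w.2 : ℝ) = a * u.2 + b * v.2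

/-- If `u` is primitive and `0 < det2 u v`, there is a lattice vector `w` with `det2 u w = 1`
and `det2 u v • w = r • u + v` for some `0 ≤ r < det2 u v`. -/
theorem exists_det2_eq_one {u v : ℤ × ℤ} (hu : Primitive u) (hdet : 0 < det2 u v) :
    ∃ (w : ℤ × ℤ) (r : ℤ), det2 u w = 1 ∧ 0 ≤ r ∧ r < det2 u v ∧
      det2 u v * w.1 = r * u.1 + v.1 ∧ det2 u v * w.2 = r * u.2 + v.2 := by
  have bez := Int.gcd_eq_gcd_ab u.1 u.2
  rw [hu.2] at bez
  set x := Int.gcdA u.1 u.2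
  set y := Int.gcdB u.1 u.2
  set d := det2 u v with hd
  set c := -(v.1 * x + v.2 * y) with hc
  have hqr := Int.mul_ediv_add_emod c d
  push_cast at bez
  refine ⟨(-y - c / d * u.1, x - c / d * u.2), c % d, ?_, Int.emod_nonneg _ hdet.ne',
    Int.emod_lt_of_pos _ hdet, ?_, ?_⟩
  · simp only [det2]
    linear_combination -bez
  · rw [det2] at hd
    linear_combination (-u.1) * hqr - v.1 * bez - y * hd + u.1 * hc
  · rw [det2] at hd
    linear_combination (-u.2) * hqr - v.2 * bez + x * hd + u.2 * hc

theorem primitive_of_det2_eq_one {u w : ℤ × ℤ} (h : det2 u w = 1) : Primitive w := by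
  rw [det2] at h
  refine ⟨?_, Int.isCoprime_iff_gcd_eq_one.mp ⟨-u.2, u.1, by linear_combination h⟩⟩
  rintro rfl
  simp at h

theorem natAbs_le_of_mul_eq {d r p q z : ℤ} {h : ℕ} (hr : 0 ≤ r) (hrd : r < d)
    (hp : p.natAbs ≤ h) (hq : q.natAbs ≤ h) (hz : d * z = r * p + q) : z.natAbs ≤ h := by
  zify at *
  rw [abs_le] at *
  constructor <;> by_contra! hlt <;> nlinarith

/-- Every cone of the complete fan `Σ_h` is smooth. -/
theorem complete_fan_smooth (h : ℕ) (hh : 1 ≤ h) (u v : ℤ × ℤ)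
    (hu : Primitive u) (hv : Primitive v) (huh : hgt u ≤ h) (hvh : hgt v ≤ h)
    (hdet : 0 < det2 u v)
    (hempty : ∀ w : ℤ × ℤ, Primitive w → hgt w ≤ h → ¬ InOpenCone u v w) :
    det2 u v = 1 := by
  obtain ⟨w, r, hw, hr, hrd, h1, h2⟩ := exists_det2_eq_one hu hdet
  generalize det2 u v = d at *
  rcases hr.eq_or_lt with rfl | hr0
  · have hdvd : d ∣ (Int.gcd v.1 v.2 : ℤ) :=
      Int.dvd_coe_gcd ⟨w.1, by linear_combination -h1⟩ ⟨w.2, by linear_combination -h2⟩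
    rw [hv.2] at hdvd
    exact Int.eq_one_of_dvd_one hdet.le hdvd
  · have hwh : hgt w ≤ h := by
      simp only [hgt] at *
      exact max_le (natAbs_le_of_mul_eq hr hrd (by omega) (by omega) h1)
        (natAbs_le_of_mul_eq hr hrd (by omega) (by omega) h2)
    refine absurd ⟨r / d, 1 / d, ?_, ?_, ?_, ?_⟩ (hempty w (primitive_of_det2_eq_one hw) hwh)
    · positivity
    · positivity
    · have h1' : (d : ℝ) * w.1 = r * u.1 + v.1 := mod_cast h1
      field_simp
      linear_combination h1'
    · have h2' : (d : ℝ) * w.2 = r * u.2 + v.2 := mod_cast h2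
      field_simp
      linear_combination h2'
end

section
/- Claim (neighbors in Σ_h lie along a line parallel to the ray): Let u, g ∈ ℤ² be primitive vectors with det(g,u) = 1, set h₀ = max(‖u‖, ‖g‖), and assume no primitive vector w with ‖w‖ ≤ h₀ lies in the open cone between g and u (i.e. g and u are adjacent at height h₀). Then for every integer h ≥ h₀, the set {s ∈ ℕ : ‖g + s·u‖ ≤ h} is nonempty and bounded; letting a be its maximum and v = g + a·u, the vector v is primitive, ‖v‖ ≤ h, det(v,u) = 1, and no primitive vector w with ‖w‖ ≤ h lies in the open cone between v and u. That is, g + a·u is the neighbor of u (on the side of g) in the complete fan Σ_h. -/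
theorem hgt_add_le (v w : ℤ × ℤ) : hgt (v + w) ≤ hgt v + hgt w := by
  simp only [hgt, Prod.fst_add, Prod.snd_add]
  omega

theorem hgt_smul (n : ℕ) (w : ℤ × ℤ) : hgt ((n : ℤ) • w) = n * hgt w := by
  simp [hgt, Int.natAbs_mul, Nat.mul_max_mul_left]

theorem hgt_pos {w : ℤ × ℤ} (hw : w ≠ 0) : 0 < hgt w := by
  by_contra h0
  apply hw
  simp only [hgt] at h0
  ext
  · simp only [Prod.fst_zero]; omega
  · simp only [Prod.snd_zero]; omega

theorem primitive_of_det2_eq_one_s4 {v u : ℤ × ℤ} (hd : det2 v u = 1) : Primitive v := by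
  refine ⟨?_, ?_⟩
  · rintro rfl
    simp [det2] at hd
  · rw [← Int.isCoprime_iff_gcd_eq_one]
    exact ⟨u.2, -u.1, by simp only [det2] at hd; linarith⟩

/-- Lattice points in the open cone over a unimodular basis have positive integer coordinates. -/
theorem exists_nat_of_inOpenCone {v u w : ℤ × ℤ} (hd : det2 v u = 1) (hw : InOpenCone v u w) :
    ∃ p q : ℕ, 0 < p ∧ 0 < q ∧ w = (p : ℤ) • v + (q : ℤ) • u := by
  obtain ⟨a, b, ha, hb, h1, h2⟩ := hw
  have hdR : (v.1 : ℝ) * u.2 - v.2 * u.1 = 1 := by exact_mod_cast hd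
  have hp : ((det2 w u : ℤ) : ℝ) = a := by
    simp only [det2]; push_cast; rw [h1, h2]; linear_combination a * hdR
  have hq : ((det2 v w : ℤ) : ℝ) = b := by
    simp only [det2]; push_cast; rw [h1, h2]; linear_combination b * hdR
  rw [← hp] at ha
  rw [← hq] at hb
  have hp0 : 0 < det2 w u := by exact_mod_cast ha
  have hq0 : 0 < det2 v w := by exact_mod_cast hb
  refine ⟨(det2 w u).toNat, (det2 v w).toNat, by omega, by omega, ?_⟩
  rw [Int.toNat_of_nonneg hp0.le, Int.toNat_of_nonneg hq0.le]
  simp only [det2] at hd ⊢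
  ext
  · simp only [Prod.fst_add, Prod.smul_fst, smul_eq_mul]
    linear_combination -w.1 * hd
  · simp only [Prod.snd_add, Prod.smul_snd, smul_eq_mul]
    linear_combination -w.2 * hd

/-- If `v`, `u` and a positive integer combination of them have height at most `h`,
so does `v + u`. -/
theorem hgt_add_le_of_combination {v u : ℤ × ℤ} {h p q : ℕ} (hv : hgt v ≤ h) (hu : hgt u ≤ h)
    (hp : 0 < p) (hq : 0 < q) (hw : hgt ((p : ℤ) • v + (q : ℤ) • u) ≤ h) :
    hgt (v + u) ≤ h := by
  wlog hqp : q ≤ p generalizing v u p q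
  · rw [add_comm]
    exact this hu hv hq hp (by rwa [add_comm]) (by omega)
  obtain ⟨k, rfl⟩ := Nat.exists_eq_add_of_le hqp
  have hsum : ((q + k : ℕ) : ℤ) • (v + u) =
      (((q + k : ℕ) : ℤ) • v + (q : ℤ) • u) + (k : ℤ) • u := by
    push_cast; module
  have hle := hgt_add_le (((q + k : ℕ) : ℤ) • v + (q : ℤ) • u) ((k : ℤ) • u)
  rw [← hsum, hgt_smul, hgt_smul] at hle
  refine le_of_mul_le_mul_left (a := q + k) ?_ hp
  nlinarith [Nat.mul_le_mul_left k hu, Nat.mul_le_mul_right h (Nat.succ_le_of_lt hq)]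

theorem bddAbove_hgt_add_smul_le (g : ℤ × ℤ) {u : ℤ × ℤ} (hu : u ≠ 0) (h : ℕ) :
    BddAbove {s : ℕ | hgt (g + (s : ℤ) • u) ≤ h} := by
  refine ⟨h + hgt g, fun s hs => ?_⟩
  have hs' : hgt (g + (s : ℤ) • u) ≤ h := hs
  have hneg : hgt (-g) = hgt g := by simp [hgt]
  have hle := hgt_add_le (g + (s : ℤ) • u) (-g)
  rw [add_neg_cancel_comm, hgt_smul, hneg] at hle
  have := Nat.le_mul_of_pos_right s (hgt_pos hu)
  omega

/-- The neighbors of a ray `u` in the complete fans `Σ_h` (on the side of `g`),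
as `h` grows, all lie along the line `{g + s·u : s ∈ ℕ}` parallel to `u`. -/
theorem neighbors_on_line (u g : ℤ × ℤ) (hu : Primitive u) (hg : Primitive g)
    (hdet : det2 g u = 1)
    (hadj : ∀ w : ℤ × ℤ, Primitive w → hgt w ≤ max (hgt u) (hgt g) →
      ¬ InOpenCone g u w)
    (h : ℕ) (hh : max (hgt u) (hgt g) ≤ h) :
    ({s : ℕ | hgt (g + (s : ℤ) • u) ≤ h}).Nonempty ∧
    BddAbove {s : ℕ | hgt (g + (s : ℤ) • u) ≤ h} ∧
    ∃ a : ℕ, IsGreatest {s : ℕ | hgt (g + (s : ℤ) • u) ≤ h} a ∧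
      Primitive (g + (a : ℤ) • u) ∧
      hgt (g + (a : ℤ) • u) ≤ h ∧
      det2 (g + (a : ℤ) • u) u = 1 ∧
      ∀ w : ℤ × ℤ, Primitive w → hgt w ≤ h →
        ¬ InOpenCone (g + (a : ℤ) • u) u w := by
  have hne : ({s : ℕ | hgt (g + (s : ℤ) • u) ≤ h}).Nonempty :=
    ⟨0, by simpa using (le_max_right _ _).trans hh⟩
  have hbdd := bddAbove_hgt_add_smul_le g hu.1 h
  have hmem := Nat.sSup_mem hne hbdd
  refine ⟨hne, hbdd, _, ⟨hmem, fun s hs => le_csSup hbdd hs⟩, ?_⟩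
  generalize hsup : sSup {s : ℕ | hgt (g + (s : ℤ) • u) ≤ h} = a at hmem ⊢
  have hd : det2 (g + (a : ℤ) • u) u = 1 := by
    simp only [det2, Prod.fst_add, Prod.snd_add, Prod.smul_fst, Prod.smul_snd, smul_eq_mul]
      at hdet ⊢
    linear_combination hdet
  refine ⟨primitive_of_det2_eq_one_s4 hd, hmem, hd, fun w _ hw hcone => ?_⟩
  obtain ⟨p, q, hp, hq, rfl⟩ := exists_nat_of_inOpenCone hd hcone
  have hnext := hgt_add_le_of_combination hmem ((le_max_left _ _).trans hh) hp hq hw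
  have hle : a + 1 ≤ sSup {s : ℕ | hgt (g + (s : ℤ) • u) ≤ h} := by
    refine le_csSup hbdd ?_
    change hgt (g + ((a + 1 : ℕ) : ℤ) • u) ≤ h
    convert hnext using 2
    push_cast
    module
  omega
end

section
/- Proposition (location bounds for rays of given singularity index, quantitative form): Let h > 0 and ε ≥ 0 be real numbers, k ≥ 1 an integer, and let u, τ, ω ∈ ℝ² be nonzero vectors such that k·u = τ + ω, h − ‖u‖ ≤ ‖τ‖ ≤ h, h − ‖u‖ ≤ ‖ω‖ ≤ h, and ‖ τ/‖τ‖ − ω/‖ω‖ ‖ ≤ ε. Then ((2 − ε)/(k + 2))·h ≤ ‖u‖ ≤ (2/k)·h. -/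
/-- The sup norm on `ℝ²`. -/
def supNorm (x : ℝ × ℝ) : ℝ := max |x.1| |x.2|

theorem supNorm_eq_norm (x : ℝ × ℝ) : supNorm x = ‖x‖ := rfl

section NormedSpace

variable {E : Type*} [NormedAddCommGroup E] [NormedSpace ℝ E]

/-- The norm of a sum is at least the sum of the norms, up to an error controlled by the
distance between the normalized vectors. -/
theorem norm_add_norm_le_norm_add_add_mul {x y : E} (hx : x ≠ 0) (hy : y ≠ 0) :
    ‖x‖ + ‖y‖ ≤ ‖x + y‖ + ‖y‖ * ‖‖x‖⁻¹ • x - ‖y‖⁻¹ • y‖ := by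
  have hx' : ‖x‖ ≠ 0 := norm_ne_zero_iff.mpr hx
  have hy' : ‖y‖ ≠ 0 := norm_ne_zero_iff.mpr hy
  have key : (‖x‖ + ‖y‖) • (‖x‖⁻¹ • x) = (x + y) + ‖y‖ • (‖x‖⁻¹ • x - ‖y‖⁻¹ • y) := by
    rw [add_smul, smul_sub, smul_inv_smul₀ hx', smul_inv_smul₀ hy']
    abel
  calc ‖x‖ + ‖y‖ = ‖(‖x‖ + ‖y‖) • (‖x‖⁻¹ • x)‖ := by
        rw [norm_smul, norm_smul, norm_inv, norm_norm, inv_mul_cancel₀ hx', mul_one,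
          Real.norm_of_nonneg (by positivity)]
    _ ≤ ‖x + y‖ + ‖‖y‖ • (‖x‖⁻¹ • x - ‖y‖⁻¹ • y)‖ := key ▸ norm_add_le _ _
    _ = ‖x + y‖ + ‖y‖ * ‖‖x‖⁻¹ • x - ‖y‖⁻¹ • y‖ := by rw [norm_smul, norm_norm]

/-- A symmetrized form of `norm_add_norm_le_norm_add_add_mul`. -/
theorem two_sub_mul_norm_add_norm_le {x y : E} (hx : x ≠ 0) (hy : y ≠ 0) {ε : ℝ}
    (h : ‖‖x‖⁻¹ • x - ‖y‖⁻¹ • y‖ ≤ ε) : (2 - ε) * (‖x‖ + ‖y‖) ≤ 2 * ‖x + y‖ := by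
  have hxy := norm_add_norm_le_norm_add_add_mul hx hy
  have hyx := norm_add_norm_le_norm_add_add_mul hy hx
  rw [norm_sub_rev, add_comm y x] at hyx
  have := mul_le_mul_of_nonneg_left h (norm_nonneg x)
  have := mul_le_mul_of_nonneg_left h (norm_nonneg y)
  linarith

end NormedSpace

/-- Quantitative location bounds for a ray of singularity index `k`: if
`k·u = τ + ω` with `τ, ω` of norm between `h − ‖u‖` and `h` and angular gap at
most `ε`, then `((2 − ε)/(k + 2))·h ≤ ‖u‖ ≤ (2/k)·h`. -/
theorem singular_ray_location (h ε : ℝ) (hh : 0 < h) (hε : 0 ≤ ε) (k : ℕ)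
    (hk : 1 ≤ k) (u τ ω : ℝ × ℝ) (hu : u ≠ 0) (hτ : τ ≠ 0) (hω : ω ≠ 0)
    (hsum : (k : ℝ) • u = τ + ω)
    (hτlb : h - supNorm u ≤ supNorm τ) (hτub : supNorm τ ≤ h)
    (hωlb : h - supNorm u ≤ supNorm ω) (hωub : supNorm ω ≤ h)
    (hangle : supNorm ((supNorm τ)⁻¹ • τ - (supNorm ω)⁻¹ • ω) ≤ ε) :
    (2 - ε) / ((k : ℝ) + 2) * h ≤ supNorm u ∧ supNorm u ≤ 2 / (k : ℝ) * h := by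
  simp only [supNorm_eq_norm] at *
  have hk0 : (0 : ℝ) < k := by exact_mod_cast hk
  have hnorm : (k : ℝ) * ‖u‖ = ‖τ + ω‖ := by
    rw [← hsum, norm_smul, Real.norm_of_nonneg hk0.le]
  constructor
  · rw [div_mul_eq_mul_div, div_le_iff₀ (by positivity)]
    rcases le_total ε 2 with h2 | h2
    · have hlow := two_sub_mul_norm_add_norm_le hτ hω hangle
      have hmul : (2 - ε) * (2 * (h - ‖u‖)) ≤ (2 - ε) * (‖τ‖ + ‖ω‖) :=
        mul_le_mul_of_nonneg_left (by linarith) (by linarith)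
      have := mul_nonneg hε (norm_nonneg u)
      linarith
    · exact (mul_nonpos_of_nonpos_of_nonneg (by linarith) hh.le).trans (by positivity)
  · rw [div_mul_eq_mul_div, le_div_iff₀ hk0]
    linarith [norm_add_le τ ω]
end

section
/- Corollary (rays blowing down to singularities of index at least k have positive density): Fix an integer k ≥ 1. For each h, let S_{≥k,h} be the set of primitive vectors u ∈ ℤ² with ‖u‖ ≤ h for which there exist primitive τ, ω ∈ ℤ² with ‖τ‖ ≤ h and ‖ω‖ ≤ h such that τ and u are adjacent at height h, u and ω are adjacent at height h, and det(τ,ω) ≥ k. Then liminf_{h→∞} |S_{≥k,h}| / N_h > 0, where N_h is the number of primitive vectors of norm at most h. -/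
open Filter Topology

/-- `u` and `v` are adjacent at height `h`: they span a cone of the complete fan `Σ_h`. -/
def Adjacent (h : ℕ) (u v : ℤ × ℤ) : Prop :=
  hgt u ≤ h ∧ hgt v ≤ h ∧ 0 < det2 u v ∧
    ∀ w : ℤ × ℤ, Primitive w → hgt w ≤ h → ¬ InOpenCone u v w

open Classical in
/-- The set of primitive vectors of sup norm at most `h` (the rays of the complete fan `Σ_h`). -/
noncomputable def rays (h : ℕ) : Finset (ℤ × ℤ) :=
  (Finset.Icc (-(h : ℤ), -(h : ℤ)) ((h : ℤ), (h : ℤ))).filter (fun u => Primitive u)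

open Classical in
/-- `Sge k h`: the rays of `Σ_h` whose two neighbors `τ`, `ω` satisfy `det(τ, ω) ≥ k`,
i.e. the rays blowing down to a singular point of index at least `k`. -/
noncomputable def Sge (k h : ℕ) : Finset (ℤ × ℤ) :=
  (rays h).filter (fun u => ∃ τ ∈ rays h, ∃ ω ∈ rays h,
    Adjacent h τ u ∧ Adjacent h u ω ∧ (k : ℤ) ≤ det2 τ ω)

lemma inOpenCone_coeffs {u v w : ℤ × ℤ} (hdet : det2 u v = 1) (hw : InOpenCone u v w) :
    ∃ p q : ℤ, 0 < p ∧ 0 < q ∧ w.1 = p * u.1 + q * v.1 := by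
  obtain ⟨a, b, ha, hb, h₁, h₂⟩ := hw
  have hd : (u.1 : ℝ) * v.2 - u.2 * v.1 = 1 := by
    have := congrArg (Int.cast : ℤ → ℝ) hdet
    simpa [det2] using this
  have hp : ((det2 w v : ℤ) : ℝ) = a := by
    simp only [det2]; push_cast; rw [h₁, h₂]; linear_combination a * hd
  have hq : ((det2 u w : ℤ) : ℝ) = b := by
    simp only [det2]; push_cast; rw [h₁, h₂]; linear_combination b * hd
  refine ⟨det2 w v, det2 u w, ?_, ?_, ?_⟩
  · rw [← hp] at ha; exact_mod_cast ha
  · rw [← hq] at hb; exact_mod_cast hb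
  · simp only [det2] at hdet ⊢
    linear_combination (-w.1) * hdet

lemma adjacent_of_det2_eq_one {h : ℕ} {u v : ℤ × ℤ} (hu : hgt u ≤ h) (hv : hgt v ≤ h)
    (hdet : det2 u v = 1) (hu₁ : 0 ≤ u.1) (hv₁ : 0 ≤ v.1) (hsum : (h : ℤ) < u.1 + v.1) :
    Adjacent h u v := by
  refine ⟨hu, hv, by omega, fun w _ hwh hw => ?_⟩
  obtain ⟨p, q, hp, hq, hw₁⟩ := inOpenCone_coeffs hdet hw
  have h₁ : u.1 ≤ p * u.1 := le_mul_of_one_le_left hu₁ hp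
  have h₂ : v.1 ≤ q * v.1 := le_mul_of_one_le_left hv₁ hq
  have h₃ : w.1.natAbs ≤ h := (le_max_left _ _).trans hwh
  omega

lemma mem_rays {h : ℕ} {u : ℤ × ℤ} : u ∈ rays h ↔ Primitive u ∧ hgt u ≤ h := by
  obtain ⟨a, b⟩ := u
  simp only [rays, hgt, Finset.mem_filter, Finset.mem_Icc, Prod.mk_le_mk, max_le_iff]
  constructor
  · rintro ⟨h₁, h₂⟩
    exact ⟨h₂, by omega, by omega⟩
  · rintro ⟨h₁, h₂⟩
    exact ⟨by omega, h₁⟩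

lemma primitive_of_isCoprime {u : ℤ × ℤ} (hu : IsCoprime u.1 u.2) : Primitive u := by
  refine ⟨?_, Int.isCoprime_iff_gcd_eq_one.1 hu⟩
  rintro rfl
  exact not_isCoprime_zero_zero hu

lemma exists_dvd_sub_of_isCoprime {a b : ℤ} (hab : IsCoprime a b) (ha : 0 < a) (h c : ℤ) :
    ∃ x, h - a < x ∧ x ≤ h ∧ a ∣ b * x - c := by
  obtain ⟨s, t, hst⟩ := hab
  refine ⟨h - (h - t * c) % a, ?_, ?_, ?_⟩
  · linarith [Int.emod_lt_of_pos (h - t * c) ha]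
  · linarith [Int.emod_nonneg (h - t * c) ha.ne']
  · refine ⟨b * ((h - t * c) / a) - s * c, ?_⟩
    linear_combination b * Int.emod_def (h - t * c) a * (-1) + c * hst

lemma mem_Sge_of_isCoprime {k h : ℕ} {a b : ℤ} (hab : IsCoprime a b) (hb : 0 < b) (hba : b < a)
    (ha : (k + 2) * a ≤ h) : (a, b) ∈ Sge k h := by
  have hka : 0 ≤ (k : ℤ) * a := mul_nonneg (Nat.cast_nonneg k) (by omega)
  have hah : 2 * a ≤ h := by linarith
  obtain ⟨x, hx₁, hx₂, y, hy⟩ := exists_dvd_sub_of_isCoprime hab (by omega) h (-1)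
  obtain ⟨z, hz₁, hz₂, t, ht⟩ := exists_dvd_sub_of_isCoprime hab (by omega) h 1
  have ha₀ : 0 < a := by omega
  have hx₀ : 0 < x := by omega
  have hz₀ : 0 < z := by omega
  have hy₀ : 0 ≤ y := by nlinarith
  have hyx : y ≤ x := by nlinarith
  have ht₀ : 0 ≤ t := by nlinarith
  have htz : t ≤ z := by nlinarith
  have hgu : hgt (a, b) ≤ h := by simp only [hgt]; omega
  have hgω : hgt (x, y) ≤ h := by simp only [hgt]; omega
  have hgτ : hgt (z, t) ≤ h := by simp only [hgt]; omega
  have hω : det2 (a, b) (x, y) = 1 := by simp only [det2]; linarith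
  have hτ : det2 (z, t) (a, b) = 1 := by simp only [det2]; linarith
  have hpω : Primitive (x, y) := primitive_of_isCoprime ⟨-b, a, by linarith⟩
  have hpτ : Primitive (z, t) := primitive_of_isCoprime ⟨b, -a, by linarith⟩
  classical
  refine Finset.mem_filter.2 ⟨mem_rays.2 ⟨primitive_of_isCoprime hab, hgu⟩, (z, t),
    mem_rays.2 ⟨hpτ, hgτ⟩, (x, y), mem_rays.2 ⟨hpω, hgω⟩,
    adjacent_of_det2_eq_one hgτ hgu hτ hz₀.le ha₀.le (by dsimp only; omega),
    adjacent_of_det2_eq_one hgu hgω hω ha₀.le hx₀.le (by dsimp only; omega), ?_⟩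
  have hdet : a * det2 (z, t) (x, y) = z + x := by
    simp only [det2]; linear_combination x * ht - z * hy
  exact le_of_mul_le_mul_left (by rw [hdet]; linarith) ha₀

lemma sum_Icc_two_inv_sq_le (n : ℕ) : ∑ d ∈ Finset.Icc 2 n, ((d : ℝ) ^ 2)⁻¹ ≤ 3 / 4 := by
  have key : ∀ m : ℕ, ∑ d ∈ Finset.Icc 2 (m + 2), ((d : ℝ) ^ 2)⁻¹ ≤ 3 / 4 - 1 / (m + 2) := by
    intro m
    induction m with
    | zero => norm_num
    | succ m ih =>
      rw [show m + 1 + 2 = (m + 2) + 1 by ring, Finset.sum_Icc_succ_top (by omega)]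
      have : (((m : ℝ) + 3) ^ 2)⁻¹ ≤ 1 / ((m : ℝ) + 2) - 1 / ((m : ℝ) + 3) := by
        rw [div_sub_div _ _ (by positivity) (by positivity), inv_eq_one_div,
          div_le_div_iff₀ (by positivity) (by positivity)]
        nlinarith [(Nat.cast_nonneg m : (0 : ℝ) ≤ m)]
      push_cast
      rw [show (m : ℝ) + 2 + 1 = m + 3 by ring, show (m : ℝ) + 1 + 2 = m + 3 by ring]
      linarith
  rcases lt_or_ge n 2 with hn | hn
  · rw [Finset.Icc_eq_empty (by omega)]; norm_num
  · obtain ⟨m, rfl⟩ := Nat.exists_eq_add_of_le' hn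
    exact (key m).trans (sub_le_self _ (by positivity))

lemma card_not_coprime_le (M : ℕ) :
    (((Finset.Icc 1 M ×ˢ Finset.Icc 1 M).filter fun x => ¬ Nat.Coprime x.1 x.2).card : ℝ)
      ≤ 3 / 4 * (M : ℝ) ^ 2 := by
  have hsub : ((Finset.Icc 1 M ×ˢ Finset.Icc 1 M).filter fun x => ¬ Nat.Coprime x.1 x.2) ⊆
      (Finset.Icc 2 M).biUnion fun d => (Finset.Icc 1 (M / d) ×ˢ Finset.Icc 1 (M / d)).image
        fun x => (d * x.1, d * x.2) := by
    rintro ⟨a, b⟩ hx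
    simp only [Finset.mem_filter, Finset.mem_product, Finset.mem_Icc] at hx
    obtain ⟨⟨⟨ha, haM⟩, hb, hbM⟩, hab⟩ := hx
    have hg : 0 < Nat.gcd a b := Nat.gcd_pos_of_pos_left _ ha
    have hga := Nat.gcd_le_left b ha
    have hgb := Nat.gcd_le_right a hb
    simp only [Finset.mem_biUnion, Finset.mem_image, Finset.mem_product, Finset.mem_Icc]
    refine ⟨Nat.gcd a b, ⟨?_, hga.trans haM⟩, (a / Nat.gcd a b, b / Nat.gcd a b),
      ⟨⟨Nat.div_pos hga hg, Nat.div_le_div_right haM⟩,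
        Nat.div_pos hgb hg, Nat.div_le_div_right hbM⟩, ?_⟩
    · have : Nat.gcd a b ≠ 1 := hab
      omega
    · simp only [Nat.mul_div_cancel' (Nat.gcd_dvd_left a b),
        Nat.mul_div_cancel' (Nat.gcd_dvd_right a b)]
  have hcard := (Finset.card_le_card hsub).trans (Finset.card_biUnion_le.trans
    (Finset.sum_le_sum fun d _ => Finset.card_image_le))
  simp only [Finset.card_product, Nat.card_Icc, Nat.add_sub_cancel] at hcard
  calc _ ≤ ((∑ d ∈ Finset.Icc 2 M, M / d * (M / d) : ℕ) : ℝ) := by exact_mod_cast hcard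
    _ ≤ ∑ d ∈ Finset.Icc 2 M, ((d : ℝ) ^ 2)⁻¹ * (M : ℝ) ^ 2 := by
      push_cast
      refine Finset.sum_le_sum fun d _ => ?_
      have h₁ : ((M / d : ℕ) : ℝ) ≤ M / d := Nat.cast_div_le
      calc _ ≤ (M / d : ℝ) * (M / d) := by gcongr
        _ = _ := by rw [div_mul_div_comm, ← sq, ← sq, div_eq_inv_mul]
    _ ≤ _ := by
      rw [← Finset.sum_mul]
      exact mul_le_mul_of_nonneg_right (sum_Icc_two_inv_sq_le M) (by positivity)

lemma le_card_coprime_lt (M : ℕ) :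
    (M : ℝ) ^ 2 / 8 - 1 / 2 ≤ (((Finset.Icc 1 M ×ˢ Finset.Icc 1 M).filter
      fun x => Nat.Coprime x.1 x.2 ∧ x.2 < x.1).card : ℝ) := by
  set P := Finset.Icc 1 M ×ˢ Finset.Icc 1 M with hP
  set G := P.filter fun x => Nat.Coprime x.1 x.2 ∧ x.2 < x.1 with hG
  have hsub : P.filter (fun x => Nat.Coprime x.1 x.2) ⊆ (G ∪ G.image Prod.swap) ∪ {(1, 1)} := by
    rintro ⟨a, b⟩ hx
    simp only [hG, hP, Finset.mem_filter, Finset.mem_product, Finset.mem_Icc, Finset.mem_union,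
      Finset.mem_image, Finset.mem_singleton, Prod.exists, Prod.swap_prod_mk, Prod.mk.injEq]
      at hx ⊢
    obtain ⟨⟨ha, hb⟩, hab⟩ := hx
    rcases lt_trichotomy b a with h | rfl | h
    · exact Or.inl (Or.inl ⟨⟨ha, hb⟩, hab, h⟩)
    · have := (Nat.coprime_self b).1 hab
      exact Or.inr ⟨this, this⟩
    · exact Or.inl (Or.inr ⟨b, a, ⟨⟨hb, ha⟩, hab.symm, h⟩, rfl, rfl⟩)
  have h₁ : (P.filter fun x => Nat.Coprime x.1 x.2).card ≤ 2 * G.card + 1 := by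
    have h₂ := (Finset.card_le_card hsub).trans (Finset.card_union_le _ _)
    have h₃ := Finset.card_union_le G (G.image Prod.swap)
    have h₄ : (G.image Prod.swap).card ≤ G.card := Finset.card_image_le
    rw [Finset.card_singleton] at h₂
    omega
  have h₂ := Finset.card_filter_add_card_filter_not (s := P) (fun x => Nat.Coprime x.1 x.2)
  have h₃ : P.card = M * M := by simp [hP]
  have h₄ := card_not_coprime_le M
  rw [← hP] at h₄
  rw [h₃] at h₂
  have h₁' : ((P.filter fun x => Nat.Coprime x.1 x.2).card : ℝ) ≤ 2 * G.card + 1 := by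
    exact_mod_cast h₁
  have h₂' : ((P.filter fun x => Nat.Coprime x.1 x.2).card : ℝ) +
      (P.filter fun x => ¬ Nat.Coprime x.1 x.2).card = (M : ℝ) * M := by exact_mod_cast h₂
  nlinarith

lemma le_card_Sge (k h : ℕ) :
    ((h / (k + 2) : ℕ) : ℝ) ^ 2 / 8 - 1 / 2 ≤ ((Sge k h).card : ℝ) := by
  refine (le_card_coprime_lt (h / (k + 2))).trans ?_
  refine Nat.cast_le.2 (Finset.card_le_card_of_injOn (fun x => ((x.1 : ℤ), (x.2 : ℤ))) ?_ ?_)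
  · rintro ⟨a, b⟩ hx
    simp only [Finset.coe_filter, Set.mem_ofPred_eq, Finset.mem_product, Finset.mem_Icc] at hx
    obtain ⟨⟨⟨ha, haM⟩, hb, hbM⟩, hab, hba⟩ := hx
    refine mem_Sge_of_isCoprime (Nat.isCoprime_iff_coprime.2 hab) (by omega) (by omega) ?_
    have := (Nat.mul_le_mul_left (k + 2) haM).trans (Nat.mul_div_le h (k + 2))
    exact_mod_cast this
  · rintro ⟨a, b⟩ _ ⟨c, d⟩ _ hx
    simpa using hx

lemma card_rays_le (h : ℕ) : (rays h).card ≤ (2 * h + 1) ^ 2 := by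
  classical
  refine (Finset.card_filter_le _ _).trans ?_
  rw [Finset.card_Icc_prod, Int.card_Icc, sq]
  apply le_of_eq
  congr 1 <;> omega

/-- The rays blowing down to a singularity of index at least `k` have positive
density among all rays, in the limit `h → ∞`. -/
theorem singular_rays_positive_density (k : ℕ) (hk : 1 ≤ k) :
    0 < Filter.liminf (fun h : ℕ => ((Sge k h).card : ℝ) / ((rays h).card : ℝ)) atTop := by
  have hle : ∀ h, (Sge k h).card ≤ (rays h).card := fun h => by
    classical exact Finset.card_filter_le _ _
  set K : ℝ := (k : ℝ) + 2 with hK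
  have hKpos : 0 < K := by positivity
  have hc : 0 < 1 / (576 * K ^ 2) := by positivity
  refine hc.trans_le (le_liminf_of_le ?_ ?_)
  · refine IsBoundedUnder.isCoboundedUnder_ge (isBoundedUnder_of ⟨1, fun h => ?_⟩)
    exact div_le_one_of_le₀ (Nat.cast_le.2 (hle h)) (Nat.cast_nonneg _)
  · filter_upwards [eventually_ge_atTop (3 * (k + 2))] with h hh
    have hM : 3 ≤ h / (k + 2) := (Nat.le_div_iff_mul_le (by omega)).2 hh
    have hlt : h < (k + 2) * (h / (k + 2) + 1) := Nat.lt_mul_div_succ h (by omega)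
    have hS := le_card_Sge k h
    have hR : ((rays h).card : ℝ) ≤ (2 * h + 1) ^ 2 := by exact_mod_cast card_rays_le h
    have hSR : ((Sge k h).card : ℝ) ≤ (rays h).card := Nat.cast_le.2 (hle h)
    have hlt' : (h : ℝ) < K * (((h / (k + 2) : ℕ) : ℝ) + 1) := by
      rw [hK]; exact_mod_cast hlt
    have hh₁ : (1 : ℝ) ≤ h := by exact_mod_cast (by omega : 1 ≤ h)
    generalize h / (k + 2) = M at *
    have hM' : (3 : ℝ) ≤ M := by exact_mod_cast hM
    have hSM : (M : ℝ) ^ 2 / 16 ≤ (Sge k h).card := by nlinarith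
    have hhM : (h : ℝ) ≤ 2 * K * M := by nlinarith
    have hRM : ((rays h).card : ℝ) ≤ 36 * K ^ 2 * (M : ℝ) ^ 2 := by
      calc _ ≤ (2 * (h : ℝ) + 1) ^ 2 := hR
        _ ≤ (3 * (2 * K * M)) ^ 2 := by gcongr; linarith
        _ = _ := by ring
    have hRpos : (0 : ℝ) < (rays h).card := by nlinarith
    rw [div_le_div_iff₀ (by positivity) hRpos]
    calc _ ≤ 36 * K ^ 2 * (M : ℝ) ^ 2 := by linarith
      _ = (M : ℝ) ^ 2 / 16 * (576 * K ^ 2) := by ring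
      _ ≤ _ := by gcongr
end

section
/- Dense-case probability estimate: Let q : ℕ → ℝ with 0 ≤ q(h) ≤ 1 for all h, suppose h²·q(h) → ∞ and h·(1 − q(h)) → ∞ as h → ∞, and let c > 0 and m : ℕ → ℕ satisfy m(h) ≥ c·h² for all sufficiently large h. Then (1 − (1 − q(h))²·q(h))^{m(h)} → 0 as h → ∞. -/
open Filter Topology

theorem tendsto_sq_mul_one_sub_sq_mul_atTop {q : ℕ → ℝ} (hq : ∀ h, 0 ≤ q h ∧ q h ≤ 1)
    (h1 : Tendsto (fun h : ℕ => (h : ℝ) ^ 2 * q h) atTop atTop)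
    (h2 : Tendsto (fun h : ℕ => (h : ℝ) * (1 - q h)) atTop atTop) :
    Tendsto (fun h : ℕ => (h : ℝ) ^ 2 * ((1 - q h) ^ 2 * q h)) atTop atTop := by
  rw [tendsto_atTop]
  intro b
  filter_upwards [h1.eventually_ge_atTop (4 * |b|), h2.eventually_ge_atTop (2 * |b| + 1)]
    with h hA hB
  obtain ⟨hq0, hq1⟩ := hq h
  have hb := le_abs_self b
  have hb0 := abs_nonneg b
  rcases le_total (q h) (1 / 2) with hle | hge
  · have hsq : 1 / 4 ≤ (1 - q h) ^ 2 := by nlinarith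
    calc b ≤ 1 / 4 * ((h : ℝ) ^ 2 * q h) := by linarith
      _ ≤ (1 - q h) ^ 2 * ((h : ℝ) ^ 2 * q h) := by gcongr
      _ = (h : ℝ) ^ 2 * ((1 - q h) ^ 2 * q h) := by ring
  · have hsq : 2 * |b| ≤ ((h : ℝ) * (1 - q h)) ^ 2 := by nlinarith
    calc b ≤ ((h : ℝ) * (1 - q h)) ^ 2 * (1 / 2) := by linarith
      _ ≤ ((h : ℝ) * (1 - q h)) ^ 2 * q h := by gcongr
      _ = (h : ℝ) ^ 2 * ((1 - q h) ^ 2 * q h) := by ring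

/-- Dense-case probability estimate: if `h²·q(h) → ∞`, `h·(1 − q(h)) → ∞` and
`m(h) ≥ c·h²` eventually, then `(1 − (1 − q(h))²·q(h))^{m(h)} → 0`. -/
theorem dense_case_estimate (q : ℕ → ℝ) (hq : ∀ h, 0 ≤ q h ∧ q h ≤ 1)
    (h1 : Tendsto (fun h : ℕ => (h : ℝ) ^ 2 * q h) atTop atTop)
    (h2 : Tendsto (fun h : ℕ => (h : ℝ) * (1 - q h)) atTop atTop)
    (c : ℝ) (hc : 0 < c) (m : ℕ → ℕ)
    (hm : ∀ᶠ h : ℕ in atTop, c * (h : ℝ) ^ 2 ≤ (m h : ℝ)) :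
    Tendsto (fun h : ℕ => (1 - (1 - q h) ^ 2 * q h) ^ m h) atTop (nhds 0) := by
  have hx0 (h : ℕ) : 0 ≤ (1 - q h) ^ 2 * q h := mul_nonneg (sq_nonneg _) (hq h).1
  have hx1 (h : ℕ) : 0 ≤ 1 - (1 - q h) ^ 2 * q h := by
    obtain ⟨hq0, hq1⟩ := hq h
    have hsq : (1 - q h) ^ 2 ≤ 1 := pow_le_one₀ (by linarith) (by linarith)
    linarith [mul_le_one₀ hsq hq0 hq1]
  have hlim := Real.tendsto_exp_neg_atTop_nhds_zero.comp
    ((tendsto_sq_mul_one_sub_sq_mul_atTop hq h1 h2).const_mul_atTop hc)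
  refine squeeze_zero' (Eventually.of_forall fun h => pow_nonneg (hx1 h) _) ?_ hlim
  filter_upwards [hm] with h hmh
  calc (1 - (1 - q h) ^ 2 * q h) ^ m h
      ≤ Real.exp (-((1 - q h) ^ 2 * q h)) ^ m h :=
        pow_le_pow_left₀ (hx1 h) (Real.one_sub_le_exp_neg _) _
    _ = Real.exp (m h * -((1 - q h) ^ 2 * q h)) := (Real.exp_nat_mul _ _).symm
    _ ≤ Real.exp (-(c * ((h : ℝ) ^ 2 * ((1 - q h) ^ 2 * q h)))) :=
        Real.exp_le_exp.mpr (by nlinarith [mul_le_mul_of_nonneg_right hmh (hx0 h)])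
end
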